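/- (Dyson equation and variational principle) For every symmetric n×n real matrix A, the free energy satisfies Ω[A] = ½ inf over symmetric positive definite G of (Tr[AG] - Tr[log G] - Φ[G] - n log(2πe)); the infimum is attained at a unique G, and this unique minimizer is exactly the unique symmetric positive definite solution of the Dyson equation G⁻¹ = A - Σ[G], where Σ[G] = ∇Φ[G]. -/

import Mathlib

open MeasureTheory Matrix Filter Topology Real Asymptotics

attribute [local instance] Matrix.normedAddCommGroup Matrix.normedSpace

noncomputable section

/-- The partition function `Z[A] = ∫ exp(-½ xᵀAx - U(x)) dx`. -/
def Zfun (n : ℕ) (U : (Fin n → ℝ) → ℝ) (A : Matrix (Fin n) (Fin n) ℝ) : ℝ :=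
  ∫ x : Fin n → ℝ, Real.exp (-(1 / 2) * (x ⬝ᵥ A.mulVec x) - U x)

/-- The free energy `Ω[A] = -log Z[A]`. -/
def Omega (n : ℕ) (U : (Fin n → ℝ) → ℝ) (A : Matrix (Fin n) (Fin n) ℝ) : ℝ :=
  - Real.log (Zfun n U A)

/-- `U` is continuous with superquadratic growth: for every `c > 0`,
`U x - c * |x|² → +∞` as `|x| → ∞`. -/
def SuperQuadratic {n : ℕ} (U : (Fin n → ℝ) → ℝ) : Prop :=
  Continuous U ∧ ∀ c : ℝ, 0 < c →
    Tendsto (fun x : Fin n → ℝ => U x - c * ‖x‖ ^ 2) (cocompact _) atTop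

/-- A probability density on `ℝⁿ` with finite second moments and finite
differential entropy. -/
def IsGoodDensity {n : ℕ} (ρ : (Fin n → ℝ) → ℝ) : Prop :=
  Measurable ρ ∧ (∀ x, 0 ≤ ρ x) ∧ (∫ x, ρ x) = 1 ∧
  (∀ i j : Fin n, Integrable fun x => x i * x j * ρ x) ∧
  Integrable fun x => ρ x * Real.log (ρ x)

/-- Differential entropy `S(ρ) = -∫ ρ log ρ`. -/
def entropy {n : ℕ} (ρ : (Fin n → ℝ) → ℝ) : ℝ := - ∫ x, ρ x * Real.log (ρ x)

/-- Second-moment matrix `𝒢(ρ) = ∫ x xᵀ ρ(x) dx`. -/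
def momMatrix {n : ℕ} (ρ : (Fin n → ℝ) → ℝ) : Matrix (Fin n) (Fin n) ℝ :=
  Matrix.of fun i j => ∫ x, x i * x j * ρ x

/-- `𝓕[G;U] = sup { S(ρ) - ∫ U ρ : ρ ∈ 𝓜, 𝒢(ρ) = G }`. -/
def Ffun (n : ℕ) (U : (Fin n → ℝ) → ℝ) (G : Matrix (Fin n) (Fin n) ℝ) : ℝ :=
  sSup { r : ℝ | ∃ ρ : (Fin n → ℝ) → ℝ, IsGoodDensity ρ ∧
    (Integrable fun x => U x * ρ x) ∧ momMatrix ρ = G ∧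
    r = entropy ρ - ∫ x, U x * ρ x }

/-- The Luttinger-Ward functional `Φ[G;U] = 2𝓕[G;U] - Tr[log G] - n log(2πe)`.
(For positive definite `G`, `Tr[log G] = log det G`.) -/
def Phi (n : ℕ) (U : (Fin n → ℝ) → ℝ) (G : Matrix (Fin n) (Fin n) ℝ) : ℝ :=
  2 * Ffun n U G - Real.log G.det - (n : ℝ) * Real.log (2 * π * Real.exp 1)

/-- The continuous linear functional `H ↦ Tr[S * H]` on matrices. -/
def tracePairing {n : ℕ} (S : Matrix (Fin n) (Fin n) ℝ) :
    Matrix (Fin n) (Fin n) ℝ →L[ℝ] ℝ :=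
  LinearMap.toContinuousLinearMap
    { toFun := fun H => (S * H).trace
      map_add' := fun H K => by simp [Matrix.mul_add]
      map_smul' := fun c H => by simp [Matrix.mul_smul] }


theorem sq_lower {n : ℕ} {U : (Fin n → ℝ) → ℝ} (hU : SuperQuadratic U) (m : ℝ) :
    ∃ K : ℝ, ∀ x, m * ‖x‖ ^ 2 - K ≤ U x := by
  obtain ⟨hc, ht⟩ := hU
  have h1 := ht (|m| + 1) (by positivity)
  have hcont : Continuous (fun x : Fin n → ℝ => U x - (|m| + 1) * ‖x‖ ^ 2) := by fun_prop
  obtain ⟨x0, hx0⟩ := hcont.exists_forall_le h1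
  refine ⟨-(U x0 - (|m| + 1) * ‖x0‖ ^ 2), fun x => ?_⟩
  have h2 := hx0 x
  have h3 : m * ‖x‖ ^ 2 ≤ (|m| + 1) * ‖x‖ ^ 2 := by
    apply mul_le_mul_of_nonneg_right _ (by positivity)
    linarith [le_abs_self m]
  linarith

theorem gauss_int (n : ℕ) : Integrable (fun x : Fin n → ℝ => Real.exp (-(n : ℝ) * ‖x‖ ^ 2)) := by
  have h1 : Integrable (fun x : Fin n → ℝ => ∏ i, Real.exp (-1 * (x i) ^ 2)) := by
    apply Integrable.fintype_prod (f := fun _ t => Real.exp (-1 * t ^ 2))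
    intro i
    exact integrable_exp_neg_mul_sq one_pos
  refine h1.mono' (by fun_prop) (ae_of_all _ fun x => ?_)
  rw [Real.norm_of_nonneg (Real.exp_pos _).le, ← Real.exp_sum]
  apply Real.exp_le_exp.2
  have : ∑ i, (x i) ^ 2 ≤ ∑ _i : Fin n, ‖x‖ ^ 2 := by
    apply Finset.sum_le_sum
    intro i _
    rw [← sq_abs]
    have := norm_le_pi_norm x i
    rw [Real.norm_eq_abs] at this
    gcongr
  simp at this
  rw [← Finset.mul_sum]
  linarith

theorem base_int {n : ℕ} {U : (Fin n → ℝ) → ℝ} (hU : SuperQuadratic U) (m a : ℝ) (ha : 0 < a) :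
    Integrable (fun x : Fin n → ℝ => Real.exp (m * ‖x‖ ^ 2 - a * U x)) := by
  obtain ⟨K, hK⟩ := sq_lower hU ((m + n) / a)
  have hc := hU.1
  refine ((gauss_int n).const_mul (Real.exp (a * K))).mono' (by fun_prop) (ae_of_all _ fun x => ?_)
  rw [Real.norm_of_nonneg (Real.exp_pos _).le, ← Real.exp_add]
  apply Real.exp_le_exp.2
  have h := mul_le_mul_of_nonneg_left (hK x) ha.le
  have e : a * ((m + n) / a * ‖x‖ ^ 2 - K) = (m + n) * ‖x‖ ^ 2 - a * K := by
    field_simp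
  rw [e] at h
  linarith

theorem quad_bound {n : ℕ} (A : Matrix (Fin n) (Fin n) ℝ) :
    ∃ K : ℝ, 0 ≤ K ∧ ∀ x : Fin n → ℝ, |x ⬝ᵥ A.mulVec x| ≤ K * ‖x‖ ^ 2 := by
  refine ⟨∑ i, ∑ j, |A i j|, by positivity, fun x => ?_⟩
  simp only [dotProduct, mulVec, Finset.mul_sum]
  rw [Finset.sum_mul]
  refine (Finset.abs_sum_le_sum_abs _ _).trans (Finset.sum_le_sum fun i _ => ?_)
  rw [Finset.sum_mul]
  refine (Finset.abs_sum_le_sum_abs _ _).trans (Finset.sum_le_sum fun j _ => ?_)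
  have hi := norm_le_pi_norm x i
  have hj := norm_le_pi_norm x j
  rw [Real.norm_eq_abs] at hi hj
  rw [abs_mul, abs_mul]
  calc |x i| * (|A i j| * |x j|) = |A i j| * (|x i| * |x j|) := by ring
    _ ≤ |A i j| * (‖x‖ * ‖x‖) := by gcongr
    _ = _ := by ring

@[fun_prop]
theorem quad_cont {n : ℕ} (A : Matrix (Fin n) (Fin n) ℝ) :
    Continuous (fun x : Fin n → ℝ => x ⬝ᵥ A.mulVec x) := by
  simp only [dotProduct, mulVec]
  fun_prop

/-- the Gibbs weight -/
def wt {n : ℕ} (U : (Fin n → ℝ) → ℝ) (A : Matrix (Fin n) (Fin n) ℝ) (x : Fin n → ℝ) : ℝ :=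
  Real.exp (-(1 / 2) * (x ⬝ᵥ A.mulVec x) - U x)

theorem wt_pos {n : ℕ} (U : (Fin n → ℝ) → ℝ) (A : Matrix (Fin n) (Fin n) ℝ) (x : Fin n → ℝ) :
    0 < wt U A x := Real.exp_pos _

theorem wt_cont {n : ℕ} {U : (Fin n → ℝ) → ℝ} (hU : SuperQuadratic U)
    (A : Matrix (Fin n) (Fin n) ℝ) : Continuous (wt U A) := by
  have := hU.1
  unfold wt
  fun_prop

theorem wt_int_mul {n : ℕ} {U : (Fin n → ℝ) → ℝ} (hU : SuperQuadratic U)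
    (A : Matrix (Fin n) (Fin n) ℝ) (f : (Fin n → ℝ) → ℝ) (hf : Continuous f)
    (C m : ℝ) (hb : ∀ x, |f x| ≤ C * Real.exp (m * ‖x‖ ^ 2 + (1 / 2) * U x)) :
    Integrable (fun x => f x * wt U A x) := by
  obtain ⟨K, hK0, hK⟩ := quad_bound A
  refine ((base_int hU (m + K / 2) (1 / 2) (by norm_num)).const_mul C).mono'
    (hf.mul (wt_cont hU A)).aestronglyMeasurable (ae_of_all _ fun x => ?_)
  rw [norm_mul, Real.norm_eq_abs, Real.norm_of_nonneg (wt_pos _ _ _).le]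
  have hC : 0 ≤ C := by
    by_contra h
    push Not at h
    have := (abs_nonneg _).trans (hb x)
    have := mul_neg_of_neg_of_pos h (Real.exp_pos (m * ‖x‖ ^ 2 + (1 / 2) * U x))
    linarith
  calc |f x| * wt U A x ≤ C * Real.exp (m * ‖x‖ ^ 2 + (1 / 2) * U x) * wt U A x :=
        mul_le_mul_of_nonneg_right (hb x) (wt_pos _ _ _).le
    _ = C * Real.exp (m * ‖x‖ ^ 2 + (1 / 2) * U x + (-(1 / 2) * (x ⬝ᵥ A.mulVec x) - U x)) := by
        rw [wt, Real.exp_add _ (-(1 / 2) * (x ⬝ᵥ A.mulVec x) - U x), mul_assoc]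
    _ ≤ _ := by
        apply mul_le_mul_of_nonneg_left _ hC
        apply Real.exp_le_exp.2
        have := (abs_le.1 (hK x)).1
        linarith

theorem wt_int_poly {n : ℕ} {U : (Fin n → ℝ) → ℝ} (hU : SuperQuadratic U)
    (A : Matrix (Fin n) (Fin n) ℝ) (f : (Fin n → ℝ) → ℝ) (hf : Continuous f)
    (C m : ℝ) (hC : 0 ≤ C) (hb : ∀ x, |f x| ≤ C * Real.exp (m * ‖x‖ ^ 2)) :
    Integrable (fun x => f x * wt U A x) := by
  obtain ⟨K, hK⟩ := sq_lower hU 0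
  refine wt_int_mul hU A f hf (C * Real.exp (K / 2)) m fun x => (hb x).trans ?_
  rw [mul_assoc, ← Real.exp_add]
  apply mul_le_mul_of_nonneg_left _ hC
  apply Real.exp_le_exp.2
  have := hK x
  linarith

theorem wt_int {n : ℕ} {U : (Fin n → ℝ) → ℝ} (hU : SuperQuadratic U)
    (A : Matrix (Fin n) (Fin n) ℝ) : Integrable (wt U A) := by
  have := wt_int_poly hU A (fun _ => 1) (by fun_prop) 1 0 (by norm_num) (by simp)
  simpa using this

theorem wt_int_mom {n : ℕ} {U : (Fin n → ℝ) → ℝ} (hU : SuperQuadratic U)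
    (A : Matrix (Fin n) (Fin n) ℝ) (i j : Fin n) : Integrable (fun x => x i * x j * wt U A x) := by
  refine wt_int_poly hU A (fun x => x i * x j) (by fun_prop) 1 1 (by norm_num) fun x => ?_
  have hi := norm_le_pi_norm x i
  have hj := norm_le_pi_norm x j
  rw [Real.norm_eq_abs] at hi hj
  rw [abs_mul]
  have : |x i| * |x j| ≤ ‖x‖ * ‖x‖ := by gcongr
  have := Real.add_one_le_exp (1 * ‖x‖ ^ 2)
  nlinarith

theorem wt_int_U {n : ℕ} {U : (Fin n → ℝ) → ℝ} (hU : SuperQuadratic U)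
    (A : Matrix (Fin n) (Fin n) ℝ) : Integrable (fun x => U x * wt U A x) := by
  obtain ⟨K, hK⟩ := sq_lower hU 0
  refine wt_int_mul hU A U hU.1 (2 * Real.exp (|K|)) 0 fun x => ?_
  rw [mul_assoc, ← Real.exp_add]
  have h1 := Real.add_one_le_exp (|K| + (0 * ‖x‖ ^ 2 + 1 / 2 * U x))
  have h2 := hK x
  have h3 := le_abs_self K
  rw [abs_le]
  constructor <;> nlinarith [abs_nonneg K]

theorem Z_pos {n : ℕ} {U : (Fin n → ℝ) → ℝ} (hU : SuperQuadratic U)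
    (A : Matrix (Fin n) (Fin n) ℝ) : 0 < Zfun n U A :=
  integral_pos_of_integrable_nonneg_nonzero (f := wt U A) (x := 0) (wt_cont hU A) (wt_int hU A)
    (fun x => (wt_pos _ _ _).le) (wt_pos _ _ _).ne'

theorem quad_mom {n : ℕ} (A : Matrix (Fin n) (Fin n) ℝ) {ρ : (Fin n → ℝ) → ℝ}
    (h : ∀ i j : Fin n, Integrable fun x => x i * x j * ρ x) :
    Integrable (fun x => (x ⬝ᵥ A.mulVec x) * ρ x) ∧
    ∫ x, (x ⬝ᵥ A.mulVec x) * ρ x = (A * momMatrix ρ).trace := by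
  have e : (fun x => (x ⬝ᵥ A.mulVec x) * ρ x) =
      fun x => ∑ i, ∑ j, A i j * (x j * x i * ρ x) := by
    funext x
    simp only [dotProduct, mulVec, Finset.mul_sum, Finset.sum_mul]
    refine Finset.sum_congr rfl fun i _ => Finset.sum_congr rfl fun j _ => by ring
  have hi : ∀ i j, Integrable fun x => A i j * (x j * x i * ρ x) :=
    fun i j => (h j i).const_mul _
  rw [e]
  refine ⟨integrable_finsetSum _ fun i _ => integrable_finsetSum _ fun j _ => hi i j, ?_⟩
  rw [integral_finsetSum _ fun i _ => integrable_finsetSum _ fun j _ => hi i j]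
  simp only [Matrix.trace, Matrix.diag, Matrix.mul_apply, momMatrix, Matrix.of_apply]
  refine Finset.sum_congr rfl fun i _ => ?_
  rw [integral_finsetSum _ fun j _ => hi i j]
  refine Finset.sum_congr rfl fun j _ => ?_
  rw [integral_const_mul]

theorem good_int {n : ℕ} {ρ : (Fin n → ℝ) → ℝ} (h : IsGoodDensity ρ) : Integrable ρ := by
  by_contra hc
  have := h.2.2.1
  rw [integral_undef hc] at this
  norm_num at this

theorem gibbs {n : ℕ} {U : (Fin n → ℝ) → ℝ} (hU : SuperQuadratic U)
    (A : Matrix (Fin n) (Fin n) ℝ) {ρ : (Fin n → ℝ) → ℝ} (h : IsGoodDensity ρ)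
    (hUr : Integrable fun x => U x * ρ x) :
    entropy ρ - ∫ x, U x * ρ x ≤ Real.log (Zfun n U A) + (1 / 2) * (A * momMatrix ρ).trace := by
  have hZ := Z_pos hU A
  have hρ := good_int h
  obtain ⟨hq, hqe⟩ := quad_mom A h.2.2.2.1
  have hpt : ∀ x, ρ x - (Zfun n U A)⁻¹ * wt U A x ≤
      ρ x * Real.log (ρ x) + (1 / 2) * ((x ⬝ᵥ A.mulVec x) * ρ x) + U x * ρ x
        + Real.log (Zfun n U A) * ρ x := by
    intro x
    have hy : 0 < (Zfun n U A)⁻¹ * wt U A x := mul_pos (inv_pos.2 hZ) (wt_pos _ _ _)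
    have hl : Real.log ((Zfun n U A)⁻¹ * wt U A x) =
        - Real.log (Zfun n U A) + (-(1 / 2) * (x ⬝ᵥ A.mulVec x) - U x) := by
      rw [Real.log_mul (inv_pos.2 hZ).ne' (wt_pos _ _ _).ne', Real.log_inv, wt, Real.log_exp]
    have key : ρ x - (Zfun n U A)⁻¹ * wt U A x ≤
        ρ x * Real.log (ρ x) - ρ x * Real.log ((Zfun n U A)⁻¹ * wt U A x) := by
      generalize (Zfun n U A)⁻¹ * wt U A x = y at hy
      rcases (h.2.1 x).eq_or_lt with h0 | h0
      · rw [← h0]; simp; exact hy.le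
      · have := Real.log_le_sub_one_of_pos (div_pos hy h0)
        rw [Real.log_div hy.ne' h0.ne'] at this
        have h2 := mul_le_mul_of_nonneg_left this h0.le
        have h3 : ρ x * (y / ρ x - 1) = y - ρ x := by field_simp
        rw [h3] at h2
        linarith
    rw [hl] at key
    linarith
  have hw := (wt_int hU A).const_mul (Zfun n U A)⁻¹
  have hI1 : Integrable fun x => ρ x * Real.log (ρ x) + (1 / 2) * ((x ⬝ᵥ A.mulVec x) * ρ x) :=
    (h.2.2.2.2.add (hq.const_mul (1 / 2)))
  have hI2 : Integrable fun x => ρ x * Real.log (ρ x) + (1 / 2) * ((x ⬝ᵥ A.mulVec x) * ρ x)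
      + U x * ρ x := hI1.add hUr
  have hI3 := hI2.add (hρ.const_mul (Real.log (Zfun n U A)))
  have hint := integral_mono (hρ.sub hw) hI3 hpt
  simp only [Pi.sub_apply, Pi.add_apply] at hint
  rw [integral_sub hρ hw, integral_add hI2 (hρ.const_mul _), integral_add hI1 hUr,
    integral_add h.2.2.2.2 (hq.const_mul _), integral_const_mul, integral_const_mul,
    integral_const_mul, h.2.2.1, hqe] at hint
  have : ∫ x, wt U A x = Zfun n U A := rfl
  rw [this, inv_mul_cancel₀ hZ.ne'] at hint
  unfold entropy
  linarith

/-- the Gibbs density -/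
def rhoA {n : ℕ} (U : (Fin n → ℝ) → ℝ) (A : Matrix (Fin n) (Fin n) ℝ) (x : Fin n → ℝ) : ℝ :=
  (Zfun n U A)⁻¹ * wt U A x

theorem rhoA_mom_int {n : ℕ} {U : (Fin n → ℝ) → ℝ} (hU : SuperQuadratic U)
    (A : Matrix (Fin n) (Fin n) ℝ) (i j : Fin n) : Integrable fun x => x i * x j * rhoA U A x := by
  have := (wt_int_mom hU A i j).const_mul (Zfun n U A)⁻¹
  refine this.congr (ae_of_all _ fun x => ?_)
  simp only [rhoA]; ring

theorem rhoA_U_int {n : ℕ} {U : (Fin n → ℝ) → ℝ} (hU : SuperQuadratic U)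
    (A : Matrix (Fin n) (Fin n) ℝ) : Integrable fun x => U x * rhoA U A x := by
  have := (wt_int_U hU A).const_mul (Zfun n U A)⁻¹
  refine this.congr (ae_of_all _ fun x => ?_)
  simp only [rhoA]; ring

theorem rhoA_one {n : ℕ} {U : (Fin n → ℝ) → ℝ} (hU : SuperQuadratic U)
    (A : Matrix (Fin n) (Fin n) ℝ) : ∫ x, rhoA U A x = 1 := by
  simp only [rhoA]
  rw [integral_const_mul]
  exact inv_mul_cancel₀ (Z_pos hU A).ne'

theorem rhoA_log {n : ℕ} {U : (Fin n → ℝ) → ℝ} (hU : SuperQuadratic U)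
    (A : Matrix (Fin n) (Fin n) ℝ) : (fun x => rhoA U A x * Real.log (rhoA U A x)) =
      fun x => (-Real.log (Zfun n U A)) * rhoA U A x +
        ((-(1 / 2)) * ((x ⬝ᵥ A.mulVec x) * rhoA U A x) - U x * rhoA U A x) := by
  funext x
  have hl : Real.log (rhoA U A x) =
        - Real.log (Zfun n U A) + (-(1 / 2) * (x ⬝ᵥ A.mulVec x) - U x) := by
    rw [rhoA, Real.log_mul (inv_pos.2 (Z_pos hU A)).ne' (wt_pos _ _ _).ne', Real.log_inv, wt,
      Real.log_exp]
  rw [hl]; ring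

theorem rhoA_good {n : ℕ} {U : (Fin n → ℝ) → ℝ} (hU : SuperQuadratic U)
    (A : Matrix (Fin n) (Fin n) ℝ) : IsGoodDensity (rhoA U A) := by
  refine ⟨((wt_cont hU A).measurable.const_mul _), fun x =>
    (mul_pos (inv_pos.2 (Z_pos hU A)) (wt_pos _ _ _)).le, rhoA_one hU A, rhoA_mom_int hU A, ?_⟩
  rw [rhoA_log hU A]
  exact (((wt_int hU A).const_mul _).const_mul _).add
    (((quad_mom A (rhoA_mom_int hU A)).1.const_mul _).sub (rhoA_U_int hU A))

theorem rhoA_val {n : ℕ} {U : (Fin n → ℝ) → ℝ} (hU : SuperQuadratic U)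
    (A : Matrix (Fin n) (Fin n) ℝ) :
    entropy (rhoA U A) - ∫ x, U x * rhoA U A x =
      Real.log (Zfun n U A) + (1 / 2) * (A * momMatrix (rhoA U A)).trace := by
  obtain ⟨hq, hqe⟩ := quad_mom A (rhoA_mom_int hU A)
  have h1 := good_int (rhoA_good hU A)
  have h2 : Integrable fun x => (-(1 / 2)) * ((x ⬝ᵥ A.mulVec x) * rhoA U A x) - U x * rhoA U A x :=
    (hq.const_mul _).sub (rhoA_U_int hU A)
  unfold entropy
  rw [rhoA_log hU A, integral_add (h1.const_mul _) h2,
    integral_sub (hq.const_mul _) (rhoA_U_int hU A), integral_const_mul, integral_const_mul, hqe,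
    rhoA_one hU A]
  ring

theorem rhoA_posDef {n : ℕ} {U : (Fin n → ℝ) → ℝ} (hU : SuperQuadratic U)
    (A : Matrix (Fin n) (Fin n) ℝ) : (momMatrix (rhoA U A)).PosDef := by
  apply Matrix.PosDef.of_dotProduct_mulVec_pos
  · ext i j
    simp only [momMatrix, Matrix.conjTranspose_apply, Matrix.of_apply, star_trivial]
    congr 1; funext x; ring
  · intro v hv
    obtain ⟨hq, hqe⟩ := quad_mom (Matrix.vecMulVec v v) (rhoA_mom_int hU A)
    have e1 : star v ⬝ᵥ (momMatrix (rhoA U A)).mulVec v =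
        (Matrix.vecMulVec v v * momMatrix (rhoA U A)).trace := by
      rw [star_trivial, Matrix.vecMulVec_mul, Matrix.trace_vecMulVec, Matrix.dotProduct_mulVec,
        dotProduct_comm]
    rw [e1, ← hqe]
    have e2 : ∀ x : Fin n → ℝ, x ⬝ᵥ (Matrix.vecMulVec v v).mulVec x = (x ⬝ᵥ v) ^ 2 := by
      intro x
      rw [Matrix.vecMulVec_mulVec]
      simp [dotProduct_comm v x, sq]
    have hr : ∀ x, 0 < rhoA U A x := fun x => mul_pos (inv_pos.2 (Z_pos hU A)) (wt_pos _ _ _)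
    refine integral_pos_of_integrable_nonneg_nonzero (x := v) ?_ hq ?_ ?_
    · have := wt_cont hU A
      unfold rhoA
      fun_prop
    · intro x
      simp only [e2, Pi.zero_apply]
      exact mul_nonneg (sq_nonneg _) (hr x).le
    · simp only [e2]
      refine mul_ne_zero (pow_ne_zero _ ?_) (hr v).ne'
      rwa [Ne, dotProduct_self_eq_zero]

theorem Z_deriv {n : ℕ} {U : (Fin n → ℝ) → ℝ} (hU : SuperQuadratic U)
    (A H : Matrix (Fin n) (Fin n) ℝ) :
    HasDerivAt (fun t : ℝ => Zfun n U (A + t • H))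
      (-(1 / 2) * ∫ x, (x ⬝ᵥ H.mulVec x) * wt U A x) 0 := by
  obtain ⟨KA, hKA0, hKA⟩ := quad_bound A
  obtain ⟨KH, hKH0, hKH⟩ := quad_bound H
  have hc := hU.1
  have key := hasDerivAt_integral_of_dominated_loc_of_deriv_le (μ := (volume : Measure (Fin n → ℝ)))
    (F := fun (t : ℝ) x => Real.exp (-(1 / 2) * (x ⬝ᵥ A.mulVec x + t * (x ⬝ᵥ H.mulVec x)) - U x))
    (F' := fun (t : ℝ) x => Real.exp (-(1 / 2) * (x ⬝ᵥ A.mulVec x + t * (x ⬝ᵥ H.mulVec x)) - U x) *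
      (-(1 / 2) * (x ⬝ᵥ H.mulVec x)))
    (x₀ := 0) (s := Metric.ball 0 1)
    (bound := fun x => KH * Real.exp ((1 + (KA + KH) / 2) * ‖x‖ ^ 2 - 1 * U x))
    (Metric.ball_mem_nhds _ one_pos)
    (Eventually.of_forall fun t => by
      apply Continuous.aestronglyMeasurable; fun_prop)
    (by
      have := wt_int hU A
      refine this.congr (ae_of_all _ fun x => ?_)
      simp [wt])
    (by apply Continuous.aestronglyMeasurable; fun_prop)
    (ae_of_all _ fun x t ht => by
      rw [norm_mul, Real.norm_of_nonneg (Real.exp_pos _).le, Real.norm_eq_abs, abs_mul]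
      have ht : |t| < 1 := by simpa using ht
      have h1 := (abs_le.1 (hKA x)).1
      have h2 : |t * (x ⬝ᵥ H.mulVec x)| ≤ 1 * (KH * ‖x‖ ^ 2) := by
        rw [abs_mul]
        exact mul_le_mul ht.le (hKH x) (abs_nonneg _) zero_le_one
      have h3 := (abs_le.1 h2).1
      have h4 : |-(1 / 2 : ℝ)| * |x ⬝ᵥ H.mulVec x| ≤ KH * Real.exp (‖x‖ ^ 2) := by
        have e : |-(1 / 2 : ℝ)| = 1 / 2 := by rw [abs_neg, abs_of_pos]; norm_num
        rw [e]
        have := Real.add_one_le_exp (‖x‖ ^ 2)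
        have h5 : KH * ‖x‖ ^ 2 ≤ KH * Real.exp (‖x‖ ^ 2) := by
          apply mul_le_mul_of_nonneg_left _ hKH0
          linarith
        linarith [hKH x, abs_nonneg (x ⬝ᵥ H.mulVec x)]
      calc _ ≤ Real.exp ((KA + KH) / 2 * ‖x‖ ^ 2 - U x) * (KH * Real.exp (‖x‖ ^ 2)) := by
            apply mul_le_mul _ h4 (by positivity) (Real.exp_pos _).le
            apply Real.exp_le_exp.2
            linarith
        _ = _ := by
            rw [mul_left_comm, ← Real.exp_add]
            congr 2
            ring)
    ((base_int hU _ 1 one_pos).const_mul KH)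
    (ae_of_all _ fun x t _ => by
      apply HasDerivAt.exp
      have h1 : HasDerivAt (fun t : ℝ => x ⬝ᵥ A.mulVec x + t * (x ⬝ᵥ H.mulVec x))
          (x ⬝ᵥ H.mulVec x) t := by
        simpa using ((hasDerivAt_id t).mul_const (x ⬝ᵥ H.mulVec x)).const_add (x ⬝ᵥ A.mulVec x)
      exact (h1.const_mul (-(1 / 2))).sub_const _)
  have h2 := key.2
  have e1 : (fun t : ℝ => Zfun n U (A + t • H)) = fun t : ℝ => ∫ x,
      Real.exp (-(1 / 2) * (x ⬝ᵥ A.mulVec x + t * (x ⬝ᵥ H.mulVec x)) - U x) := by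
    funext t
    simp only [Zfun, Matrix.add_mulVec, Matrix.smul_mulVec, dotProduct_add, dotProduct_smul,
      smul_eq_mul]
  rw [e1, ← integral_const_mul]
  refine h2.congr_deriv ?_
  congr 1
  funext x
  simp only [wt, zero_mul, add_zero]
  ring

theorem logZ_deriv {n : ℕ} {U : (Fin n → ℝ) → ℝ} (hU : SuperQuadratic U)
    (A H : Matrix (Fin n) (Fin n) ℝ) :
    HasDerivAt (fun t : ℝ => Real.log (Zfun n U (A + t • H)))
      (-(1 / 2) * (H * momMatrix (rhoA U A)).trace) 0 := by
  have h := (Z_deriv hU A H).log (by simpa using (Z_pos hU A).ne')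
  convert h using 1
  rw [← (quad_mom H (rhoA_mom_int hU A)).2]
  simp only [rhoA, zero_smul, add_zero]
  rw [show (fun x : Fin n → ℝ => x ⬝ᵥ H *ᵥ x * ((Zfun n U A)⁻¹ * wt U A x)) =
    fun x => (Zfun n U A)⁻¹ * (x ⬝ᵥ H *ᵥ x * wt U A x) by funext x; ring, integral_const_mul]
  ring

theorem box_int {n : ℕ} (f : Fin n → ℝ → ℝ) :
    ∫ x in Set.pi Set.univ (fun _ : Fin n => Set.Icc (-1 : ℝ) 1), ∏ i, f i (x i) =
      ∏ i, ∫ t in Set.Icc (-1 : ℝ) 1, f i t := by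
  rw [volume_pi, Measure.restrict_pi_pi, integral_fintype_prod_eq_prod]

theorem box_mom {n : ℕ} (k l : Fin n) :
    ∫ x in Set.pi Set.univ (fun _ : Fin n => Set.Icc (-1 : ℝ) 1), x k * x l =
      if k = l then 2 ^ n / 3 else 0 := by
  have e : (fun x : Fin n → ℝ => x k * x l) = fun x =>
      ∏ i, (if i = k then x i else 1) * (if i = l then x i else 1) := by
    funext x
    rw [Finset.prod_mul_distrib]
    simp
  rw [e, box_int (fun i t => (if i = k then t else 1) * (if i = l then t else 1))]
  have h1 : ∫ t in Set.Icc (-1 : ℝ) 1, (1 : ℝ) = 2 := by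
    rw [integral_Icc_eq_integral_Ioc, ← intervalIntegral.integral_of_le (by norm_num)]
    norm_num
  have h2 : ∫ t in Set.Icc (-1 : ℝ) 1, t = 0 := by
    rw [integral_Icc_eq_integral_Ioc, ← intervalIntegral.integral_of_le (by norm_num)]
    norm_num
  have h3 : ∫ t in Set.Icc (-1 : ℝ) 1, t * t = 2 / 3 := by
    rw [integral_Icc_eq_integral_Ioc, ← intervalIntegral.integral_of_le (by norm_num)]
    simp only [← pow_two]
    norm_num
  split_ifs with h
  · subst h
    rw [← Finset.mul_prod_erase _ _ (Finset.mem_univ k)]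
    have : ∀ i ∈ Finset.univ.erase k, ∫ t in Set.Icc (-1 : ℝ) 1,
        (if i = k then t else 1) * (if i = k then t else 1) = 2 := by
      intro i hi
      have := (Finset.mem_erase.1 hi).1
      simp only [this, if_false, mul_one]
      exact h1
    rw [Finset.prod_congr rfl this]
    simp only [if_true, h3, Finset.prod_const, Finset.card_erase_of_mem (Finset.mem_univ k),
      Finset.card_univ, Fintype.card_fin]
    have hn : n ≠ 0 := fun h => by subst h; exact k.elim0
    obtain ⟨m, rfl⟩ := Nat.exists_eq_succ_of_ne_zero hn
    simp [pow_succ]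
    ring
  · apply Finset.prod_eq_zero (Finset.mem_univ k)
    simp only [if_true, h, if_false, mul_one]
    exact h2

theorem box_one {n : ℕ} :
    ∫ _x in Set.pi Set.univ (fun _ : Fin n => Set.Icc (-1 : ℝ) 1), (1 : ℝ) = 2 ^ n := by
  have := box_int (n := n) (fun _ _ => 1)
  have h1 : ∫ t in Set.Icc (-1 : ℝ) 1, (1 : ℝ) = 2 := by
    rw [integral_Icc_eq_integral_Ioc, ← intervalIntegral.integral_of_le (by norm_num)]
    norm_num
  rw [h1] at this
  simpa using this

open scoped MatrixOrder in
theorem posDef_fac {n : ℕ} {G : Matrix (Fin n) (Fin n) ℝ} (hG : G.PosDef) :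
    ∃ M : Matrix (Fin n) (Fin n) ℝ, M.det ≠ 0 ∧ M * Mᵀ = G := by
  have h0 : (0 : Matrix (Fin n) (Fin n) ℝ) ≤ G := hG.posSemidef.nonneg
  refine ⟨(CFC.sqrt G), ?_, ?_⟩
  · intro h
    have h1 := CFC.sqrt_mul_sqrt_self G h0
    have h2 := congrArg Matrix.det h1
    rw [Matrix.det_mul, h, zero_mul] at h2
    exact hG.det_pos.ne h2
  · have h1 : (CFC.sqrt G)ᵀ = CFC.sqrt G := by
      have := (CFC.sqrt_nonneg G).posSemidef.isHermitian
      simpa [Matrix.IsHermitian, Matrix.conjTranspose_eq_transpose_of_trivial] using this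
    rw [h1]
    exact CFC.sqrt_mul_sqrt_self G h0

theorem lin_int {n : ℕ} {M : Matrix (Fin n) (Fin n) ℝ} (hM : M.det ≠ 0) (s : Set (Fin n → ℝ))
    (hs : MeasurableSet s) (g : (Fin n → ℝ) → ℝ) :
    ∫ x in (fun y => M.mulVec y) '' s, g x = |M.det| * ∫ y in s, g (M.mulVec y) := by
  have h := integral_image_eq_integral_abs_det_fderiv_smul (volume : Measure (Fin n → ℝ)) hs
    (f := fun y => M.mulVec y)
    (f' := fun _ => LinearMap.toContinuousLinearMap (Matrix.toLin' M))
    (fun x _ => (LinearMap.toContinuousLinearMap (Matrix.toLin' M)).hasFDerivWithinAt)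
    ((Matrix.mulVec_injective_of_isUnit
      ((Matrix.isUnit_iff_isUnit_det M).2 (isUnit_iff_ne_zero.2 hM))).injOn) g
  rw [h]
  simp only [smul_eq_mul, ContinuousLinearMap.det, LinearMap.coe_toContinuousLinearMap,
    LinearMap.det_toLin']
  rw [integral_const_mul]

theorem exists_density {n : ℕ} {U : (Fin n → ℝ) → ℝ} (hU : SuperQuadratic U)
    {G : Matrix (Fin n) (Fin n) ℝ} (hG : G.PosDef) :
    ∃ ρ : (Fin n → ℝ) → ℝ, IsGoodDensity ρ ∧
    (Integrable fun x => U x * ρ x) ∧ momMatrix ρ = G := by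
  obtain ⟨M, hM, hMG⟩ := posDef_fac (hG.smul (show (0 : ℝ) < 3 by norm_num))
  set B : Set (Fin n → ℝ) := Set.pi Set.univ (fun _ : Fin n => Set.Icc (-1 : ℝ) 1) with hB
  have hBc : IsCompact B := isCompact_univ_pi fun _ => isCompact_Icc
  have hBm : MeasurableSet B := hBc.measurableSet
  have hMc : Continuous fun y : Fin n → ℝ => M.mulVec y := by fun_prop
  set S := (fun y => M.mulVec y) '' B with hS
  have hSc : IsCompact S := hBc.image hMc
  have hSm : MeasurableSet S := hSc.measurableSet
  set c : ℝ := (|M.det| * 2 ^ n)⁻¹ with hc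
  have hdet : 0 < |M.det| := abs_pos.2 hM
  have hcpos : 0 < c := by positivity
  have hmul : ∀ f : (Fin n → ℝ) → ℝ, (fun x => f x * S.indicator (fun _ => c) x) =
      S.indicator (fun x => f x * c) := by
    intro f; funext x
    by_cases hx : x ∈ S <;> simp [hx]
  have hcint : ∀ f : (Fin n → ℝ) → ℝ, Continuous f →
      Integrable (fun x => f x * S.indicator (fun _ => c) x) := by
    intro f hf
    rw [hmul, integrable_indicator_iff hSm]
    exact (hf.mul continuous_const).continuousOn.integrableOn_compact hSc
  have hval : ∀ f : (Fin n → ℝ) → ℝ, ∫ x, f x * S.indicator (fun _ => c) x =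
      (2 ^ n : ℝ)⁻¹ * ∫ y in B, f (M.mulVec y) := by
    intro f
    rw [hmul, integral_indicator hSm, integral_mul_const, lin_int hM B hBm, hc]
    field_simp
  refine ⟨S.indicator (fun _ => c), ⟨measurable_const.indicator hSm,
    fun x => Set.indicator_nonneg (fun _ _ => hcpos.le) x, ?_, fun i j => hcint _ (by fun_prop), ?_⟩,
    hcint U hU.1, ?_⟩
  · have := hval (fun _ => 1)
    simp only [one_mul] at this
    rw [this, box_one]
    field_simp
  · have e : (fun x => S.indicator (fun _ => c) x * Real.log (S.indicator (fun _ => c) x)) =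
        fun x => Real.log c * S.indicator (fun _ => c) x := by
      funext x
      by_cases hx : x ∈ S <;> simp [hx, mul_comm]
    rw [e]
    exact hcint _ continuous_const
  · ext i j
    simp only [momMatrix, Matrix.of_apply]
    rw [hval (fun x => x i * x j)]
    have e : (fun y : Fin n → ℝ => M.mulVec y i * M.mulVec y j) = fun y =>
        ∑ k, ∑ l, M i k * M j l * (y k * y l) := by
      funext y
      simp only [mulVec, dotProduct]
      rw [Finset.sum_mul_sum]
      refine Finset.sum_congr rfl fun k _ => Finset.sum_congr rfl fun l _ => by ring
    have hi : ∀ k l, Integrable (fun y : Fin n → ℝ => M i k * M j l * (y k * y l))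
        (volume.restrict B) := fun k l =>
      (Continuous.continuousOn (by fun_prop)).integrableOn_compact hBc
    rw [e, integral_finsetSum _ fun k _ => integrable_finsetSum _ fun l _ => hi k l]
    have e2 : ∀ k, ∫ y in B, ∑ l, M i k * M j l * (y k * y l) = M i k * M j k * (2 ^ n / 3) := by
      intro k
      rw [integral_finsetSum _ fun l _ => hi k l]
      simp only [integral_const_mul, hB, box_mom]
      simp
    simp only [e2]
    rw [← Finset.sum_mul]
    have e3 : ∑ k, M i k * M j k = 3 * G i j := by
      have := congrFun (congrFun hMG i) j
      simpa [Matrix.mul_apply] using this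
    rw [e3]
    field_simp

theorem F_ge {n : ℕ} {U : (Fin n → ℝ) → ℝ} (hU : SuperQuadratic U)
    {ρ : (Fin n → ℝ) → ℝ} (h : IsGoodDensity ρ) (hi : Integrable fun x => U x * ρ x) :
    entropy ρ - ∫ x, U x * ρ x ≤ Ffun n U (momMatrix ρ) := by
  apply le_csSup
  · refine ⟨Real.log (Zfun n U 0) + (1 / 2) * (0 * momMatrix ρ).trace, ?_⟩
    rintro r ⟨ρ', h', hi', hm, rfl⟩
    rw [← hm]
    exact gibbs hU 0 h' hi'
  · exact ⟨ρ, h, hi, rfl, rfl⟩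

theorem F_le {n : ℕ} {U : (Fin n → ℝ) → ℝ} (hU : SuperQuadratic U)
    (A : Matrix (Fin n) (Fin n) ℝ) {G : Matrix (Fin n) (Fin n) ℝ} (hG : G.PosDef) :
    Ffun n U G ≤ Real.log (Zfun n U A) + (1 / 2) * (A * G).trace := by
  apply csSup_le
  · obtain ⟨ρ, h, hi, hm⟩ := exists_density hU hG
    exact ⟨_, ρ, h, hi, hm, rfl⟩
  · rintro r ⟨ρ', h', hi', hm, rfl⟩
    rw [← hm]
    exact gibbs hU A h' hi'

theorem F_eq {n : ℕ} {U : (Fin n → ℝ) → ℝ} (hU : SuperQuadratic U)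
    (A : Matrix (Fin n) (Fin n) ℝ) :
    Ffun n U (momMatrix (rhoA U A)) =
      Real.log (Zfun n U A) + (1 / 2) * (A * momMatrix (rhoA U A)).trace := by
  apply le_antisymm (F_le hU A (rhoA_posDef hU A))
  rw [← rhoA_val hU A]
  exact F_ge hU (rhoA_good hU A) (rhoA_U_int hU A)

theorem mul_log_superadd {x y : ℝ} (hx : 0 ≤ x) (hy : 0 ≤ y) :
    x * Real.log x + y * Real.log y ≤ (x + y) * Real.log (x + y) := by
  have h : ∀ {x y : ℝ}, 0 ≤ x → 0 ≤ y → x * Real.log x ≤ x * Real.log (x + y) := by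
    intro x y hx hy
    rcases hx.eq_or_lt with h0 | h0
    · rw [← h0]; simp
    · exact mul_le_mul_of_nonneg_left (Real.log_le_log h0 (by linarith)) hx
  have h1 := h hx hy
  have h2 := h hy hx
  rw [add_comm y x] at h2
  linarith

theorem mix {n : ℕ} {U : (Fin n → ℝ) → ℝ} {ρ₀ ρ₁ : (Fin n → ℝ) → ℝ} (h₀ : IsGoodDensity ρ₀)
    (h₁ : IsGoodDensity ρ₁) (hi₀ : Integrable fun x => U x * ρ₀ x)
    (hi₁ : Integrable fun x => U x * ρ₁ x) {a b : ℝ} (ha : 0 < a) (hb : 0 < b) (hab : a + b = 1) :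
    ∃ ρ : (Fin n → ℝ) → ℝ, IsGoodDensity ρ ∧ (Integrable fun x => U x * ρ x) ∧
      momMatrix ρ = a • momMatrix ρ₀ + b • momMatrix ρ₁ ∧
      a * (entropy ρ₀ - ∫ x, U x * ρ₀ x) + b * (entropy ρ₁ - ∫ x, U x * ρ₁ x) ≤
        entropy ρ - ∫ x, U x * ρ x := by
  have i₀ := good_int h₀
  have i₁ := good_int h₁
  obtain ⟨m₀, p₀, o₀, q₀, l₀⟩ := h₀
  obtain ⟨m₁, p₁, o₁, q₁, l₁⟩ := h₁
  set ρ := fun x => a * ρ₀ x + b * ρ₁ x with hρ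
  have hm : Measurable ρ := by fun_prop
  have hmulf : ∀ f : (Fin n → ℝ) → ℝ, (fun x => f x * ρ x) =
      fun x => a * (f x * ρ₀ x) + b * (f x * ρ₁ x) := by
    intro f; funext x; simp only [hρ]; ring
  have hint : ∀ f : (Fin n → ℝ) → ℝ, Integrable (fun x => f x * ρ₀ x) →
      Integrable (fun x => f x * ρ₁ x) → Integrable (fun x => f x * ρ x) := by
    intro f hf0 hf1
    rw [hmulf]
    exact (hf0.const_mul a).add (hf1.const_mul b)
  have hval : ∀ f : (Fin n → ℝ) → ℝ, Integrable (fun x => f x * ρ₀ x) →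
      Integrable (fun x => f x * ρ₁ x) → ∫ x, f x * ρ x =
        a * (∫ x, f x * ρ₀ x) + b * ∫ x, f x * ρ₁ x := by
    intro f hf0 hf1
    rw [hmulf, integral_add (hf0.const_mul a) (hf1.const_mul b), integral_const_mul,
      integral_const_mul]
  have hup : ∀ x, ρ x * Real.log (ρ x) ≤
      a * (ρ₀ x * Real.log (ρ₀ x)) + b * (ρ₁ x * Real.log (ρ₁ x)) := by
    intro x
    have := Real.convexOn_mul_log.2 (p₀ x) (p₁ x) ha.le hb.le hab
    simpa using this
  have hlow : ∀ x, (a * Real.log a) * ρ₀ x + a * (ρ₀ x * Real.log (ρ₀ x)) +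
      ((b * Real.log b) * ρ₁ x + b * (ρ₁ x * Real.log (ρ₁ x))) ≤ ρ x * Real.log (ρ x) := by
    intro x
    have h := mul_log_superadd (mul_nonneg ha.le (p₀ x)) (mul_nonneg hb.le (p₁ x))
    have e : ∀ {c y : ℝ}, 0 < c → 0 ≤ y → c * y * Real.log (c * y) =
        (c * Real.log c) * y + c * (y * Real.log y) := by
      intro c y hc hy
      rcases hy.eq_or_lt with h0 | h0
      · rw [← h0]; simp
      · rw [Real.log_mul hc.ne' h0.ne']; ring
    rw [e ha (p₀ x), e hb (p₁ x)] at h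
    exact h
  have hupI : Integrable fun x => a * (ρ₀ x * Real.log (ρ₀ x)) + b * (ρ₁ x * Real.log (ρ₁ x)) :=
    (l₀.const_mul a).add (l₁.const_mul b)
  have hlowI : Integrable fun x => (a * Real.log a) * ρ₀ x + a * (ρ₀ x * Real.log (ρ₀ x)) +
      ((b * Real.log b) * ρ₁ x + b * (ρ₁ x * Real.log (ρ₁ x))) :=
    ((i₀.const_mul _).add (l₀.const_mul a)).add ((i₁.const_mul _).add (l₁.const_mul b))
  have hl : Integrable fun x => ρ x * Real.log (ρ x) := by
    refine (hupI.abs.add hlowI.abs).mono'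
      (hm.mul (Real.measurable_log.comp hm)).aestronglyMeasurable (ae_of_all _ fun x => ?_)
    rw [Real.norm_eq_abs, abs_le]
    simp only [Pi.add_apply]
    have h1 := hup x
    have h2 := hlow x
    constructor
    · exact le_trans (by
        refine le_trans ?_ (neg_abs_le _)
        linarith [abs_nonneg (a * (ρ₀ x * Real.log (ρ₀ x)) + b * (ρ₁ x * Real.log (ρ₁ x)))]) h2
    · exact h1.trans ((le_abs_self _).trans (le_add_of_nonneg_right (abs_nonneg _)))
  refine ⟨ρ, ⟨hm, fun x => add_nonneg (mul_nonneg ha.le (p₀ x)) (mul_nonneg hb.le (p₁ x)), ?_,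
    fun i j => hint (fun x => x i * x j) (q₀ i j) (q₁ i j), hl⟩, hint U hi₀ hi₁, ?_, ?_⟩
  · have := hval (fun _ => 1) (by simpa using i₀) (by simpa using i₁)
    simp only [one_mul] at this
    rw [this, o₀, o₁]; linarith
  · ext i j
    exact hval (fun x => x i * x j) (q₀ i j) (q₁ i j)
  · rw [hval U hi₀ hi₁]
    have := integral_mono hl hupI hup
    rw [integral_add (l₀.const_mul a) (l₁.const_mul b), integral_const_mul,
      integral_const_mul] at this
    unfold entropy
    linarith

theorem F_concave {n : ℕ} {U : (Fin n → ℝ) → ℝ} (hU : SuperQuadratic U)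
    {G₀ G₁ : Matrix (Fin n) (Fin n) ℝ} (hG₀ : G₀.PosDef) (hG₁ : G₁.PosDef)
    {a b : ℝ} (ha : 0 < a) (hb : 0 < b) (hab : a + b = 1) :
    a * Ffun n U G₀ + b * Ffun n U G₁ ≤ Ffun n U (a • G₀ + b • G₁) := by
  have ex : ∀ {G : Matrix (Fin n) (Fin n) ℝ}, G.PosDef → ∀ ε > 0, ∃ ρ : (Fin n → ℝ) → ℝ,
      IsGoodDensity ρ ∧ (Integrable fun x => U x * ρ x) ∧ momMatrix ρ = G ∧
      Ffun n U G - ε < entropy ρ - ∫ x, U x * ρ x := by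
    intro G hG ε hε
    have hne : { r : ℝ | ∃ ρ : (Fin n → ℝ) → ℝ, IsGoodDensity ρ ∧
      (Integrable fun x => U x * ρ x) ∧ momMatrix ρ = G ∧
      r = entropy ρ - ∫ x, U x * ρ x }.Nonempty := by
      obtain ⟨ρ, h, hi, hm⟩ := exists_density hU hG
      exact ⟨_, ρ, h, hi, hm, rfl⟩
    obtain ⟨r, ⟨ρ, h, hi, hm, rfl⟩, hr⟩ := exists_lt_of_lt_csSup hne
      (show Ffun n U G - ε < _ from sub_lt_self _ hε)
    exact ⟨ρ, h, hi, hm, hr⟩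
  apply le_of_forall_pos_le_add
  intro ε hε
  obtain ⟨ρ₀, h₀, i₀, m₀, l₀⟩ := ex hG₀ ε hε
  obtain ⟨ρ₁, h₁, i₁, m₁, l₁⟩ := ex hG₁ ε hε
  obtain ⟨ρ, h, i, m, l⟩ := mix h₀ h₁ i₀ i₁ ha hb hab
  have := F_ge hU h i
  rw [m, m₀, m₁] at this
  have e1 := mul_lt_mul_of_pos_left l₀ ha
  have e2 := mul_lt_mul_of_pos_left l₁ hb
  have e3 : a * ε + b * ε = ε := by rw [← add_mul, hab, one_mul]
  linarith

theorem symm_trace_zero {n : ℕ} {D : Matrix (Fin n) (Fin n) ℝ} (hD : D.IsSymm)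
    (h : (D * D).trace = 0) : D = 0 := by
  rw [← Matrix.trace_conjTranspose_mul_self_eq_zero_iff,
    Matrix.conjTranspose_eq_transpose_of_trivial, hD.eq]
  exact h

theorem posDef_symm {n : ℕ} {G : Matrix (Fin n) (Fin n) ℝ} (hG : G.PosDef) : G.IsSymm := by
  have := hG.isHermitian
  rwa [Matrix.IsHermitian, Matrix.conjTranspose_eq_transpose_of_trivial] at this

theorem posDef_near {n : ℕ} {G H : Matrix (Fin n) (Fin n) ℝ} (hG : G.PosDef) (hH : H.IsSymm) :
    ∀ᶠ t : ℝ in 𝓝 0, (G + t • H).PosDef := by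
  obtain ⟨M, hM, hMG⟩ := posDef_fac hG
  have hu : IsUnit M.det := isUnit_iff_ne_zero.2 hM
  obtain ⟨K, hK0, hK⟩ := quad_bound (M⁻¹ * H * (M⁻¹)ᵀ)
  have ht : ∀ᶠ t : ℝ in 𝓝 0, |t| * K < 1 := by
    have : Continuous fun t : ℝ => |t| * K := by fun_prop
    have h := this.tendsto 0
    simp only [abs_zero, zero_mul] at h
    exact h.eventually (gt_mem_nhds one_pos)
  filter_upwards [ht] with t ht
  apply Matrix.PosDef.of_dotProduct_mulVec_pos
  · rw [Matrix.IsHermitian, Matrix.conjTranspose_eq_transpose_of_trivial, Matrix.transpose_add,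
      Matrix.transpose_smul, hH.eq, (posDef_symm hG).eq]
  · intro x hx
    set y := Mᵀ.mulVec x with hy
    have hut : IsUnit (Mᵀ).det := by rwa [Matrix.det_transpose]
    have hxy : x = (M⁻¹)ᵀ.mulVec y := by
      rw [hy, Matrix.mulVec_mulVec, Matrix.transpose_nonsing_inv, Matrix.nonsing_inv_mul _ hut,
        Matrix.one_mulVec]
    have hy0 : y ≠ 0 := by
      intro h
      rw [h, Matrix.mulVec_zero] at hxy
      exact hx hxy
    have e1 : x ⬝ᵥ G.mulVec x = y ⬝ᵥ y := by
      rw [← hMG, ← Matrix.mulVec_mulVec, Matrix.dotProduct_mulVec, ← Matrix.mulVec_transpose]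
    have e2 : x ⬝ᵥ H.mulVec x = y ⬝ᵥ (M⁻¹ * H * (M⁻¹)ᵀ).mulVec y := by
      rw [← Matrix.mulVec_mulVec, ← hxy, ← Matrix.mulVec_mulVec, Matrix.dotProduct_mulVec y,
        ← Matrix.mulVec_transpose, ← hxy]
    have h1 : ‖y‖ ^ 2 ≤ y ⬝ᵥ y := by
      have hyy : 0 ≤ y ⬝ᵥ y := by
        simp only [dotProduct]
        exact Finset.sum_nonneg fun i _ => mul_self_nonneg _
      have : ‖y‖ ≤ Real.sqrt (y ⬝ᵥ y) := by
        rw [pi_norm_le_iff_of_nonneg (Real.sqrt_nonneg _)]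
        intro i
        rw [Real.norm_eq_abs]
        apply Real.abs_le_sqrt
        rw [sq]
        exact Finset.single_le_sum (f := fun i => y i * y i) (fun i _ => mul_self_nonneg _)
          (Finset.mem_univ i)
      calc ‖y‖ ^ 2 ≤ Real.sqrt (y ⬝ᵥ y) ^ 2 := by gcongr
        _ = _ := Real.sq_sqrt hyy
    have h2 : 0 < ‖y‖ ^ 2 := by have := norm_pos_iff.2 hy0; positivity
    rw [star_trivial, Matrix.add_mulVec, Matrix.smul_mulVec, dotProduct_add, dotProduct_smul, e1, e2,
      smul_eq_mul]
    have h3 : |t * (y ⬝ᵥ (M⁻¹ * H * (M⁻¹)ᵀ).mulVec y)| ≤ |t| * K * ‖y‖ ^ 2 := by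
      rw [abs_mul, mul_assoc |t|]
      exact mul_le_mul_of_nonneg_left (hK y) (abs_nonneg _)
    have h4 := (abs_le.1 h3).1
    have h5 : |t| * K * ‖y‖ ^ 2 < 1 * ‖y‖ ^ 2 := mul_lt_mul_of_pos_right ht h2
    linarith

theorem logdet_deriv {n : ℕ} {G : Matrix (Fin n) (Fin n) ℝ} (hG : G.PosDef)
    (H : Matrix (Fin n) (Fin n) ℝ) :
    HasDerivAt (fun t : ℝ => Real.log (G + t • H).det) ((G⁻¹ * H).trace) 0 := by
  have hu : IsUnit G.det := isUnit_iff_ne_zero.2 hG.det_pos.ne'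
  have e : (fun t : ℝ => (G + t • H).det) = fun t : ℝ =>
      G.det * (1 + (G⁻¹ * H).trace * t + (Matrix.det (1 + (Polynomial.X : Polynomial ℝ) •
        (G⁻¹ * H).map Polynomial.C)).divX.divX.eval t * t ^ 2) := by
    funext t
    rw [← Matrix.det_one_add_smul, ← Matrix.det_mul, Matrix.mul_add, Matrix.mul_one,
      Matrix.mul_smul, Matrix.mul_nonsing_inv_cancel_left _ _ hu]
  have hd : HasDerivAt (fun t : ℝ => (G + t • H).det) (G.det * (G⁻¹ * H).trace) 0 := by
    rw [e]
    generalize (Matrix.det (1 + (Polynomial.X : Polynomial ℝ) •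
        (G⁻¹ * H).map Polynomial.C)).divX.divX = p
    have h1 : HasDerivAt (fun t : ℝ => 1 + (G⁻¹ * H).trace * t) ((G⁻¹ * H).trace) 0 := by
      simpa using ((hasDerivAt_id (0 : ℝ)).const_mul ((G⁻¹ * H).trace)).const_add 1
    have h2 : HasDerivAt (fun t : ℝ => p.eval t * t ^ 2) 0 0 := by
      have h := (p.hasDerivAt 0).mul (hasDerivAt_pow 2 (0 : ℝ))
      exact h.congr_deriv (by simp)
    simpa using (h1.add h2).const_mul G.det
  have := hd.log (by simpa using hG.det_pos.ne')
  convert this using 1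
  simp only [zero_smul, add_zero]
  field_simp [hG.det_pos.ne']

theorem phi_deriv {n : ℕ} {f : Matrix (Fin n) (Fin n) ℝ → ℝ} {S G H : Matrix (Fin n) (Fin n) ℝ}
    (hG : G.IsSymm) (hH : H.IsSymm)
    (h : HasFDerivWithinAt f (tracePairing S) {M : Matrix (Fin n) (Fin n) ℝ | M.IsSymm} G) :
    HasDerivAt (fun t : ℝ => f (G + t • H)) ((S * H).trace) 0 := by
  have hp : HasDerivAt (fun t : ℝ => G + t • H) H 0 := by
    have h := ((hasDerivAt_id (0 : ℝ)).smul_const H).const_add G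
    exact h.congr_deriv (by simp)
  have h' : HasFDerivWithinAt f (tracePairing S) {M : Matrix (Fin n) (Fin n) ℝ | M.IsSymm}
      (G + (0 : ℝ) • H) := by simpa using h
  have := HasFDerivWithinAt.comp_hasDerivWithinAt (s := Set.univ) (0 : ℝ) h' hp.hasDerivWithinAt
    (fun t _ => by
      show (G + t • H).IsSymm
      exact hG.add (hH.smul t))
  rw [hasDerivWithinAt_univ] at this
  exact this

theorem unique_min {n : ℕ} {U : (Fin n → ℝ) → ℝ} (hU : SuperQuadratic U)
    (A : Matrix (Fin n) (Fin n) ℝ) {G : Matrix (Fin n) (Fin n) ℝ} (hG : G.PosDef)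
    (h : Ffun n U G = Real.log (Zfun n U A) + (1 / 2) * (A * G).trace) :
    G = momMatrix (rhoA U A) := by
  set H := G - momMatrix (rhoA U A) with hH
  have hs : H.IsSymm := (posDef_symm hG).sub (posDef_symm (rhoA_posDef hU A))
  have hd : HasDerivAt (fun t : ℝ => Real.log (Zfun n U (A + t • H)) + t * ((1 / 2) * (H * G).trace))
      (-(1 / 2) * (H * momMatrix (rhoA U A)).trace + (1 / 2) * (H * G).trace) 0 := by
    have := (hasDerivAt_id (0 : ℝ)).mul_const ((1 / 2) * (H * G).trace)
    rw [one_mul] at this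
    exact (logZ_deriv hU A H).add this
  have hmin : IsLocalMin (fun t : ℝ => Real.log (Zfun n U (A + t • H)) +
      t * ((1 / 2) * (H * G).trace)) 0 := by
    refine Eventually.of_forall fun t => ?_
    have := F_le hU (A + t • H) hG
    rw [h, Matrix.add_mul, Matrix.trace_add, Matrix.smul_mul, Matrix.trace_smul, smul_eq_mul] at this
    simp only [zero_smul, add_zero, zero_mul]
    linarith
  have h0 := hmin.hasDerivAt_eq_zero hd
  have h1 : (H * H).trace = 0 := by
    nth_rw 2 [hH]
    rw [Matrix.mul_sub, Matrix.trace_sub]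
    linarith
  exact sub_eq_zero.1 (symm_trace_zero hs h1)

/-- Dyson equation and variational principle: for every symmetric `A`,
`Ω[A] = ½ inf_{G ≻ 0} (Tr[AG] - Tr[log G] - Φ[G] - n log(2πe))`; the infimum is attained
at a unique `G`, and this unique minimizer is exactly the unique symmetric positive
definite solution of the Dyson equation `G⁻¹ = A - Σ[G]`, where `Σ[G] = ∇Φ[G]`
(the gradient of `Φ` along the subspace of symmetric matrices, so that
`dΦ[G][H] = Tr[Σ[G] H]`). -/
theorem statement10 (n : ℕ) (hn : 1 ≤ n) (U : (Fin n → ℝ) → ℝ) (hU : SuperQuadratic U)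
    (Sig : Matrix (Fin n) (Fin n) ℝ → Matrix (Fin n) (Fin n) ℝ)
    (hSig : ∀ G : Matrix (Fin n) (Fin n) ℝ, G.PosDef → (Sig G).IsSymm ∧
      HasFDerivWithinAt (Phi n U) (tracePairing (Sig G))
        {M : Matrix (Fin n) (Fin n) ℝ | M.IsSymm} G)
    (A : Matrix (Fin n) (Fin n) ℝ) (hA : A.IsSymm) :
    Omega n U A = (1 / 2) * sInf { r : ℝ | ∃ G : Matrix (Fin n) (Fin n) ℝ, G.PosDef ∧
        r = (A * G).trace - Real.log G.det - Phi n U G -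
          (n : ℝ) * Real.log (2 * π * Real.exp 1) } ∧
    ∃ G : Matrix (Fin n) (Fin n) ℝ,
      (G.PosDef ∧
        (A * G).trace - Real.log G.det - Phi n U G -
            (n : ℝ) * Real.log (2 * π * Real.exp 1) =
          sInf { r : ℝ | ∃ G' : Matrix (Fin n) (Fin n) ℝ, G'.PosDef ∧
            r = (A * G').trace - Real.log G'.det - Phi n U G' -
              (n : ℝ) * Real.log (2 * π * Real.exp 1) } ∧
        G⁻¹ = A - Sig G) ∧
      ∀ G' : Matrix (Fin n) (Fin n) ℝ, G'.PosDef →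
        ((A * G').trace - Real.log G'.det - Phi n U G' -
              (n : ℝ) * Real.log (2 * π * Real.exp 1) =
            sInf { r : ℝ | ∃ G'' : Matrix (Fin n) (Fin n) ℝ, G''.PosDef ∧
              r = (A * G'').trace - Real.log G''.det - Phi n U G'' -
                (n : ℝ) * Real.log (2 * π * Real.exp 1) } ∨
          G'⁻¹ = A - Sig G') → G' = G := by
  set c : ℝ := (n : ℝ) * Real.log (2 * π * Real.exp 1) with hc
  set G₀ := momMatrix (rhoA U A) with hG₀
  have hP : G₀.PosDef := rhoA_posDef hU A
  have hf : ∀ G : Matrix (Fin n) (Fin n) ℝ, (A * G).trace - Real.log G.det - Phi n U G - c =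
      (A * G).trace - 2 * Ffun n U G := by
    intro G; unfold Phi; rw [← hc]; ring
  have hlow : ∀ G : Matrix (Fin n) (Fin n) ℝ, G.PosDef → -2 * Real.log (Zfun n U A) ≤
      (A * G).trace - Real.log G.det - Phi n U G - c := by
    intro G hG
    rw [hf]
    have := F_le hU A hG
    linarith
  have hval : (A * G₀).trace - Real.log G₀.det - Phi n U G₀ - c = -2 * Real.log (Zfun n U A) := by
    rw [hf, F_eq hU A]
    ring
  have hinf : sInf { r : ℝ | ∃ G : Matrix (Fin n) (Fin n) ℝ, G.PosDef ∧
        r = (A * G).trace - Real.log G.det - Phi n U G - c } = -2 * Real.log (Zfun n U A) := by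
    apply IsLeast.csInf_eq
    refine ⟨⟨G₀, hP, hval.symm⟩, ?_⟩
    rintro r ⟨G, hG, rfl⟩
    exact hlow G hG
  have huniq : ∀ G : Matrix (Fin n) (Fin n) ℝ, G.PosDef →
      (A * G).trace - Real.log G.det - Phi n U G - c = -2 * Real.log (Zfun n U A) → G = G₀ := by
    intro G hG h
    rw [hf] at h
    exact unique_min hU A hG (by linarith)
  rw [hinf]
  refine ⟨by unfold Omega; ring, G₀, ⟨hP, hval, ?_⟩, ?_⟩
  · obtain ⟨hSs, hSd⟩ := hSig G₀ hP
    set D := A - Sig G₀ - G₀⁻¹ with hD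
    have hDs : D.IsSymm := by
      refine (hA.sub hSs).sub ?_
      exact posDef_symm hP.inv
    have h1 := phi_deriv (posDef_symm hP) hDs hSd
    have h2 := logdet_deriv hP D
    have h3 : HasDerivAt (fun t : ℝ => (A * (G₀ + t • D)).trace) ((A * D).trace) 0 := by
      have e : (fun t : ℝ => (A * (G₀ + t • D)).trace) =
          fun t : ℝ => (A * G₀).trace + t * (A * D).trace := by
        funext t
        rw [Matrix.mul_add, Matrix.trace_add, Matrix.mul_smul, Matrix.trace_smul, smul_eq_mul]
      rw [e]
      simpa using ((hasDerivAt_id (0 : ℝ)).mul_const ((A * D).trace)).const_add (A * G₀).trace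
    have h4 := ((h3.sub h2).sub h1).sub_const c
    have hmin : IsLocalMin (fun t : ℝ => (A * (G₀ + t • D)).trace - Real.log (G₀ + t • D).det -
        Phi n U (G₀ + t • D) - c) 0 := by
      filter_upwards [posDef_near hP hDs] with t ht
      have := hlow _ ht
      simp only [zero_smul, add_zero]
      rw [hval]
      exact this
    have h5 := hmin.hasDerivAt_eq_zero h4
    have h6 : (D * D).trace = 0 := by
      nth_rw 1 [hD]
      rw [Matrix.sub_mul, Matrix.sub_mul, Matrix.trace_sub, Matrix.trace_sub]
      linarith
    have h7 := symm_trace_zero hDs h6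
    rw [hD] at h7
    exact (sub_eq_zero.1 h7).symm
  · intro G hG h
    rcases h with h | h
    · exact huniq G hG h
    · apply huniq G hG
      apply le_antisymm _ (hlow G hG)
      rw [← hval]
      obtain ⟨hSs, hSd⟩ := hSig G hG
      set H := G₀ - G with hH
      have hHs : H.IsSymm := (posDef_symm hP).sub (posDef_symm hG)
      have h1 := phi_deriv (posDef_symm hG) hHs hSd
      have h2 := logdet_deriv hG H
      have h3 := ((h1.add h2).add_const c)
      have e1 : (Sig G * H).trace + (G⁻¹ * H).trace = (A * H).trace := by
        rw [h, Matrix.sub_mul, Matrix.trace_sub]; ring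
      rw [e1] at h3
      have h4 := h3.tendsto_slope_zero_right
      have h5 : 2 * Ffun n U G₀ - 2 * Ffun n U G ≤ (A * H).trace := by
        refine ge_of_tendsto h4 ?_
        have hlt : ∀ᶠ t : ℝ in 𝓝[>] 0, t < 1 :=
          nhdsWithin_le_nhds (gt_mem_nhds one_pos)
        filter_upwards [hlt, self_mem_nhdsWithin] with t ht1 ht0
        have ht0 : 0 < t := ht0
        have hcv := F_concave hU hG hP (sub_pos.2 ht1) ht0 (by ring)
        have e2 : (1 - t) • G + t • G₀ = G + t • H := by
          rw [hH, smul_sub, sub_smul, one_smul]; abel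
        rw [e2] at hcv
        have e3 : ∀ K : Matrix (Fin n) (Fin n) ℝ,
            Phi n U K + Real.log K.det + c = 2 * Ffun n U K := by
          intro K; unfold Phi; rw [← hc]; ring
        simp only [Pi.add_apply, zero_add, zero_smul, add_zero, e3, smul_eq_mul]
        rw [le_inv_mul_iff₀ ht0]
        linarith
      rw [hf, hf]
      have e4 : (A * H).trace = (A * G₀).trace - (A * G).trace := by
        rw [hH, Matrix.mul_sub, Matrix.trace_sub]
      linarith
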